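/- For every fixed t > 0 there exist constants c₁, c₂ > 0 and an integer N ≥ 1 such that for all n ≥ N and all x ∈ ℝ³, one has c₁ · 2^{n/2} · exp(−4·2^{−n}·|x|²) ≤ ∫_{2^(−n)}^{t+2^(−n)} K_{2σ}(x,x) dσ ≤ c₂ · 2^{n/2} · exp(−2^{−n}·|x|²). -/

import Mathlib

open MeasureTheory Real

noncomputable section

/-- Mehler heat kernel of the harmonic oscillator `H = -Δ + |x|²` on `ℝ³`. -/
def mehlerK (t : ℝ) (x y : EuclideanSpace ℝ (Fin 3)) : ℝ :=
  (2 * π * Real.sinh (2 * t)) ^ (-(3 : ℝ) / 2) *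
    Real.exp (-‖x - y‖ ^ 2 / (4 * Real.tanh t) - Real.tanh t * ‖x + y‖ ^ 2 / 4)

theorem sinh_le_mul_cosh {u : ℝ} (hu : 0 ≤ u) : Real.sinh u ≤ u * Real.cosh u := by
  rcases hu.eq_or_lt with rfl | hu
  · simp
  obtain ⟨c, hc, hcu⟩ := exists_hasDerivAt_eq_slope Real.sinh Real.cosh hu
    Real.continuous_sinh.continuousOn fun x _ => Real.hasDerivAt_sinh x
  rw [Real.sinh_zero, sub_zero, sub_zero, eq_div_iff hu.ne'] at hcu
  have h : Real.cosh c ≤ Real.cosh u :=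
    Real.cosh_le_cosh.2 (abs_le_abs_of_nonneg hc.1.le hc.2.le)
  rw [← hcu, mul_comm]
  exact mul_le_mul_of_nonneg_left h hu.le

theorem tanh_le_self_of_nonneg {u : ℝ} (hu : 0 ≤ u) : Real.tanh u ≤ u := by
  rw [Real.tanh_eq_sinh_div_cosh, div_le_iff₀ (Real.cosh_pos u)]
  exact sinh_le_mul_cosh hu

theorem tanh_le_tanh_of_le {u v : ℝ} (huv : u ≤ v) : Real.tanh u ≤ Real.tanh v := by
  rw [Real.tanh_eq_sinh_div_cosh, Real.tanh_eq_sinh_div_cosh,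
    div_le_div_iff₀ (Real.cosh_pos u) (Real.cosh_pos v)]
  have h := Real.sinh_nonneg_iff.2 (sub_nonneg.2 huv)
  rw [Real.sinh_sub] at h
  linarith

theorem cosh_le_two {u : ℝ} (hu : 0 ≤ u) (hu1 : u ≤ 1) : Real.cosh u ≤ 2 := by
  have h : Real.cosh u ≤ Real.cosh 1 := Real.cosh_le_cosh.2 (abs_le_abs_of_nonneg hu hu1)
  have h₁ := Real.exp_one_lt_d9
  have h₂ : Real.exp (-1) ≤ 1 := Real.exp_le_one_iff.2 (by norm_num)
  rw [Real.cosh_eq 1] at h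
  linarith

theorem sinh_le_two_mul {u : ℝ} (hu : 0 ≤ u) (hu1 : u ≤ 1) : Real.sinh u ≤ 2 * u := by
  nlinarith [sinh_le_mul_cosh hu, cosh_le_two hu hu1]

theorem half_le_tanh {u : ℝ} (hu : 0 ≤ u) (hu1 : u ≤ 1) : u / 2 ≤ Real.tanh u := by
  rw [Real.tanh_eq_sinh_div_cosh, le_div_iff₀ (Real.cosh_pos u)]
  nlinarith [Real.self_le_sinh_iff.2 hu, cosh_le_two hu hu1]

theorem mehlerK_diag (σ : ℝ) (x : EuclideanSpace ℝ (Fin 3)) :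
    mehlerK (2 * σ) x x =
      (2 * π * Real.sinh (4 * σ)) ^ (-(3 : ℝ) / 2) *
        Real.exp (-(Real.tanh (2 * σ) * ‖x‖ ^ 2)) := by
  have h : ‖x + x‖ = 2 * ‖x‖ := by
    rw [← two_smul ℝ x, norm_smul, Real.norm_ofNat]
  rw [mehlerK, h, sub_self, norm_zero]
  congr 2 <;> ring_nf

theorem mehlerK_nonneg {s : ℝ} (hs : 0 ≤ s) (x y : EuclideanSpace ℝ (Fin 3)) :
    0 ≤ mehlerK s x y := by
  have : 0 ≤ Real.sinh (2 * s) := Real.sinh_nonneg_iff.2 (by positivity)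
  unfold mehlerK
  positivity

theorem continuousOn_mehlerK_diag (x : EuclideanSpace ℝ (Fin 3)) :
    ContinuousOn (fun σ => mehlerK (2 * σ) x x) (Set.Ioi 0) := by
  simp only [mehlerK_diag, Real.tanh_eq_sinh_div_cosh]
  refine ContinuousOn.mul (ContinuousOn.rpow_const ?_ fun σ hσ => Or.inl ?_) ?_
  · exact (continuous_const.mul
      (Real.continuous_sinh.comp (continuous_const.mul continuous_id))).continuousOn
  · have : 0 < Real.sinh (4 * σ) := Real.sinh_pos_iff.2 (mul_pos (by norm_num) hσ)
    positivity
  · refine Continuous.continuousOn (Real.continuous_exp.comp (Continuous.neg ?_))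
    exact ((Real.continuous_sinh.comp (continuous_const.mul continuous_id)).div
      (Real.continuous_cosh.comp (continuous_const.mul continuous_id))
      fun σ => (Real.cosh_pos _).ne').mul continuous_const

theorem intervalIntegrable_mehlerK_diag {a b : ℝ} (ha : 0 < a) (hab : a ≤ b)
    (x : EuclideanSpace ℝ (Fin 3)) :
    IntervalIntegrable (fun σ => mehlerK (2 * σ) x x) volume a b := by
  refine ((continuousOn_mehlerK_diag x).mono ?_).intervalIntegrable
  rw [Set.uIcc_of_le hab]
  exact fun σ hσ => ha.trans_le hσ.1

theorem mehlerK_diag_le {a σ : ℝ} (ha : 0 < a) (ha1 : 2 * a ≤ 1) (hσ : a ≤ σ)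
    (x : EuclideanSpace ℝ (Fin 3)) :
    mehlerK (2 * σ) x x ≤ σ ^ (-(3 : ℝ) / 2) * Real.exp (-a * ‖x‖ ^ 2) := by
  have hσ0 : 0 < σ := ha.trans_le hσ
  have hsinh : 4 * σ ≤ Real.sinh (4 * σ) := Real.self_le_sinh_iff.2 (by positivity)
  have htanh : a ≤ Real.tanh (2 * σ) := by
    have h₁ := half_le_tanh (u := 2 * a) (by positivity) ha1
    have h₂ := tanh_le_tanh_of_le (u := 2 * a) (v := 2 * σ) (by linarith)
    linarith
  rw [mehlerK_diag, neg_mul]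
  refine mul_le_mul (Real.rpow_le_rpow_of_nonpos hσ0 ?_ (by norm_num)) ?_ (by positivity)
    (by positivity)
  · nlinarith [Real.pi_gt_three]
  · gcongr

theorem le_mehlerK_diag {a σ : ℝ} (ha : 0 < a) (ha1 : 8 * a ≤ 1) (hσ : a ≤ σ)
    (hσa : σ ≤ 2 * a) (x : EuclideanSpace ℝ (Fin 3)) :
    (32 * π * a) ^ (-(3 : ℝ) / 2) * Real.exp (-4 * a * ‖x‖ ^ 2) ≤ mehlerK (2 * σ) x x := by
  have hσ0 : 0 < σ := ha.trans_le hσ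
  have hpos : 0 < Real.sinh (4 * σ) := Real.sinh_pos_iff.2 (by positivity)
  have hsinh := sinh_le_two_mul (u := 4 * σ) (by positivity) (by linarith)
  have htanh : Real.tanh (2 * σ) ≤ 4 * a := by
    have := tanh_le_self_of_nonneg (u := 2 * σ) (by positivity)
    linarith
  rw [mehlerK_diag, neg_mul, neg_mul]
  refine mul_le_mul (Real.rpow_le_rpow_of_nonpos (by positivity) ?_ (by norm_num)) ?_
    (by positivity) (by positivity)
  · nlinarith [Real.pi_pos]
  · gcongr

theorem integral_mehlerK_diag_le {a t : ℝ} (ha : 0 < a) (ha1 : 2 * a ≤ 1) (ht : 0 ≤ t)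
    (x : EuclideanSpace ℝ (Fin 3)) :
    ∫ σ in a..(t + a), mehlerK (2 * σ) x x ≤
      2 * a ^ (-(1 : ℝ) / 2) * Real.exp (-a * ‖x‖ ^ 2) := by
  have hab : a ≤ t + a := by linarith
  have h0 : (0 : ℝ) ∉ Set.uIcc a (t + a) := by
    rw [Set.uIcc_of_le hab]
    exact fun h => ha.not_ge h.1
  calc ∫ σ in a..(t + a), mehlerK (2 * σ) x x
      ≤ ∫ σ in a..(t + a), σ ^ (-(3 : ℝ) / 2) * Real.exp (-a * ‖x‖ ^ 2) :=
        intervalIntegral.integral_mono_on hab (intervalIntegrable_mehlerK_diag ha hab x)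
          ((intervalIntegral.intervalIntegrable_rpow (Or.inr h0)).mul_const _)
          fun σ hσ => mehlerK_diag_le ha ha1 hσ.1 x
    _ = 2 * (a ^ (-(1 : ℝ) / 2) - (t + a) ^ (-(1 : ℝ) / 2)) * Real.exp (-a * ‖x‖ ^ 2) := by
        rw [intervalIntegral.integral_mul_const, integral_rpow (Or.inr ⟨by norm_num, h0⟩),
          show -(3 : ℝ) / 2 + 1 = -1 / 2 by norm_num]
        ring
    _ ≤ 2 * a ^ (-(1 : ℝ) / 2) * Real.exp (-a * ‖x‖ ^ 2) := by
        have : 0 ≤ (t + a) ^ (-(1 : ℝ) / 2) := by positivity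
        gcongr
        linarith

theorem le_integral_mehlerK_diag {a t : ℝ} (ha : 0 < a) (ha1 : 8 * a ≤ 1) (hat : a ≤ t)
    (x : EuclideanSpace ℝ (Fin 3)) :
    (32 * π) ^ (-(3 : ℝ) / 2) * a ^ (-(1 : ℝ) / 2) * Real.exp (-4 * a * ‖x‖ ^ 2) ≤
      ∫ σ in a..(t + a), mehlerK (2 * σ) x x := by
  have hab : a ≤ 2 * a := by linarith
  have hpow : a ^ (-(1 : ℝ) / 2) = a * a ^ (-(3 : ℝ) / 2) := by
    rw [← Real.rpow_one_add' ha.le (by norm_num)]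
    norm_num
  calc (32 * π) ^ (-(3 : ℝ) / 2) * a ^ (-(1 : ℝ) / 2) * Real.exp (-4 * a * ‖x‖ ^ 2)
      = ∫ _ in a..(2 * a), (32 * π * a) ^ (-(3 : ℝ) / 2) * Real.exp (-4 * a * ‖x‖ ^ 2) := by
        rw [intervalIntegral.integral_const, smul_eq_mul, hpow,
          Real.mul_rpow (by positivity) ha.le]
        ring
    _ ≤ ∫ σ in a..(2 * a), mehlerK (2 * σ) x x :=
        intervalIntegral.integral_mono_on hab intervalIntegrable_const
          (intervalIntegrable_mehlerK_diag ha hab x)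
          fun σ hσ => le_mehlerK_diag ha ha1 hσ.1 hσ.2 x
    _ ≤ ∫ σ in a..(t + a), mehlerK (2 * σ) x x := by
        refine intervalIntegral.integral_mono_interval le_rfl hab (by linarith) ?_
          (intervalIntegrable_mehlerK_diag ha (by linarith) x)
        refine (ae_restrict_iff' measurableSet_Ioc).2 (ae_of_all _ fun σ hσ => ?_)
        exact mehlerK_nonneg (by linarith [hσ.1]) x x

/-- two-sided Gaussian-weighted `2^{n/2}` bounds on
`∫_{2^{-n}}^{t+2^{-n}} K_{2σ}(x,x) dσ`, for `n` large, uniformly in `x`. -/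
theorem c1_two_sided_bound (t : ℝ) (ht : 0 < t) :
    ∃ c₁ c₂ : ℝ, 0 < c₁ ∧ 0 < c₂ ∧ ∃ N : ℕ, 1 ≤ N ∧
      ∀ n : ℕ, N ≤ n → ∀ x : EuclideanSpace ℝ (Fin 3),
        c₁ * (2 : ℝ) ^ ((n : ℝ) / 2) * Real.exp (-4 * (2 : ℝ) ^ (-(n : ℝ)) * ‖x‖ ^ 2) ≤
            (∫ σ in ((2 : ℝ) ^ (-(n : ℝ)))..(t + (2 : ℝ) ^ (-(n : ℝ))), mehlerK (2 * σ) x x) ∧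
          (∫ σ in ((2 : ℝ) ^ (-(n : ℝ)))..(t + (2 : ℝ) ^ (-(n : ℝ))), mehlerK (2 * σ) x x) ≤
            c₂ * (2 : ℝ) ^ ((n : ℝ) / 2) * Real.exp (-(2 : ℝ) ^ (-(n : ℝ)) * ‖x‖ ^ 2) := by
  obtain ⟨N, hN⟩ := exists_pow_lt_of_lt_one (lt_min ht (by norm_num : (0 : ℝ) < 1 / 8))
    (by norm_num : (1 / 2 : ℝ) < 1)
  refine ⟨(32 * π) ^ (-(3 : ℝ) / 2), 2, by positivity, two_pos, N + 1, by omega,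
    fun n hn x => ?_⟩
  have ha : (0 : ℝ) < 2 ^ (-(n : ℝ)) := by positivity
  have hle : (2 : ℝ) ^ (-(n : ℝ)) < min t (1 / 8) := by
    refine lt_of_le_of_lt ?_ hN
    rw [Real.rpow_neg two_pos.le, Real.rpow_natCast, ← inv_pow, ← one_div]
    exact pow_le_pow_of_le_one (by norm_num) (by norm_num) (by omega)
  have hpow : (2 : ℝ) ^ ((n : ℝ) / 2) = ((2 : ℝ) ^ (-(n : ℝ))) ^ (-(1 : ℝ) / 2) := by
    rw [← Real.rpow_mul two_pos.le]
    ring_nf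
  have hat := hle.trans_le (min_le_left _ _)
  have ha8 := hle.trans_le (min_le_right _ _)
  rw [hpow]
  exact ⟨le_integral_mehlerK_diag ha (by linarith) hat.le x,
    integral_mehlerK_diag_le ha (by linarith) ht.le x⟩

end
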